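/- arXiv:1211.3590 — 3 statements merged into one kernel-verified Lean document; each statement's English description precedes it below -/
import Mathlib

section
/- The element C⁽²⁾ = −q⁻²K₁⁻²K₂⁻² − K₁⁻²K₃⁻² − q²K₂⁻²K₃⁻² − qκ_q²F₁E₁K₁⁻¹K₂⁻¹K₃⁻² − q⁻¹κ_q²F₂E₂K₁⁻²K₂⁻¹K₃⁻¹ − qκ_q²F₃E₃K₁⁻¹K₂⁻²K₃⁻¹ − qκ_q³F₁F₂E₃K₁⁻¹K₂⁻²K₃⁻¹ is central in U_q(gl₃); that is, C⁽²⁾ commutes with each of the generators E₁, E₂, F₁, F₂, K₁, K₂, K₃ of A. -/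
theorem aux_inv {A : Type*} [Ring A] [Algebra ℂ A] {K K' x : A} {c d : ℂ} (hcd : d * c = 1)
    (h1 : K * K' = 1) (h2 : K' * K = 1) (h : K * x = c • (x * K)) : K' * x = d • (x * K') := by
  have e : K' * (K * x) * K' = c • (K' * (x * (K * K'))) := by
    rw [h]; simp only [mul_smul_comm, smul_mul_assoc, mul_assoc]
  rw [← mul_assoc, h2, one_mul, h1, mul_one] at e
  rw [e, smul_smul, hcd, one_smul]

theorem aux_inv1 {A : Type*} [Ring A] {K K' x : A}
    (h1 : K * K' = 1) (h2 : K' * K = 1) (h : K * x = x * K) : K' * x = x * K' := by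
  have e : K' * (K * x) * K' = K' * (x * (K * K')) := by
    rw [h]; simp only [mul_assoc]
  rw [← mul_assoc, h2, one_mul, h1, mul_one] at e
  exact e.symm

theorem aux_as {A : Type*} [Ring A] {a b c : A} (h : a * b = c) (x : A) :
    a * (b * x) = c * x := by rw [← mul_assoc, h]

set_option linter.all false
set_option linter.unusedSimpArgs false

set_option maxHeartbeats 4000000 in
/-- The quantum Casimir element `C⁽²⁾` of `U_q(gl₃)` is central. -/
theorem casimir_C2_central
    {A : Type*} [Ring A] [Algebra ℂ A]
    (q : ℂ) (hq0 : q ≠ 0) (hq2 : q ^ 2 ≠ 1)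
    (K1 K2 K3 K1' K2' K3' E1 E2 F1 F2 E3 F3 : A)
    (hK1 : K1 * K1' = 1) (hK1' : K1' * K1 = 1)
    (hK2 : K2 * K2' = 1) (hK2' : K2' * K2 = 1)
    (hK3 : K3 * K3' = 1) (hK3' : K3' * K3 = 1)
    (hK12 : K1 * K2 = K2 * K1) (hK13 : K1 * K3 = K3 * K1) (hK23 : K2 * K3 = K3 * K2)
    (hK1E1 : K1 * E1 = q • (E1 * K1)) (hK2E1 : K2 * E1 = q⁻¹ • (E1 * K2))
    (hK3E1 : K3 * E1 = E1 * K3)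
    (hK1E2 : K1 * E2 = E2 * K1) (hK2E2 : K2 * E2 = q • (E2 * K2))
    (hK3E2 : K3 * E2 = q⁻¹ • (E2 * K3))
    (hK1F1 : K1 * F1 = q⁻¹ • (F1 * K1)) (hK2F1 : K2 * F1 = q • (F1 * K2))
    (hK3F1 : K3 * F1 = F1 * K3)
    (hK1F2 : K1 * F2 = F2 * K1) (hK2F2 : K2 * F2 = q⁻¹ • (F2 * K2))
    (hK3F2 : K3 * F2 = q • (F2 * K3))
    (hEF1 : E1 * F1 - F1 * E1 = (q - q⁻¹)⁻¹ • (K1 * K2' - K1' * K2))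
    (hEF2 : E2 * F2 - F2 * E2 = (q - q⁻¹)⁻¹ • (K2 * K3' - K2' * K3))
    (hEF12 : E1 * F2 = F2 * E1) (hEF21 : E2 * F1 = F1 * E2)
    (hSE1 : E1 ^ 2 * E2 - (q + q⁻¹) • (E1 * E2 * E1) + E2 * E1 ^ 2 = 0)
    (hSE2 : E2 ^ 2 * E1 - (q + q⁻¹) • (E2 * E1 * E2) + E1 * E2 ^ 2 = 0)
    (hSF1 : F1 ^ 2 * F2 - (q + q⁻¹) • (F1 * F2 * F1) + F2 * F1 ^ 2 = 0)
    (hSF2 : F2 ^ 2 * F1 - (q + q⁻¹) • (F2 * F1 * F2) + F1 * F2 ^ 2 = 0)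
    (hE3 : E3 = E1 * E2 - q⁻¹ • (E2 * E1))
    (hF3 : F3 = F2 * F1 - q • (F1 * F2))
    (C2 : A)
    (hC2 : C2 = -((q⁻¹ ^ 2) • (K1' * K1' * (K2' * K2'))) - K1' * K1' * (K3' * K3')
      - (q ^ 2) • (K2' * K2' * (K3' * K3'))
      - (q * (q - q⁻¹) ^ 2) • (F1 * E1 * (K1' * K2' * (K3' * K3')))
      - (q⁻¹ * (q - q⁻¹) ^ 2) • (F2 * E2 * (K1' * K1' * (K2' * K3')))
      - (q * (q - q⁻¹) ^ 2) • (F3 * E3 * (K1' * (K2' * K2') * K3'))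
      - (q * (q - q⁻¹) ^ 3) • (F1 * F2 * E3 * (K1' * (K2' * K2') * K3'))) :
    C2 * E1 = E1 * C2 ∧ C2 * E2 = E2 * C2 ∧ C2 * F1 = F1 * C2 ∧ C2 * F2 = F2 * C2 ∧ C2 * K1 = K1 * C2 ∧ C2 * K2 = K2 * C2 ∧ C2 * K3 = K3 * C2 := by
  have hqi : q⁻¹ * q = 1 := inv_mul_cancel₀ hq0
  have hqi' : q * q⁻¹ = 1 := mul_inv_cancel₀ hq0
  have hd : q ^ 2 - 1 ≠ 0 := sub_ne_zero.mpr hq2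
  have c121 : K2 * K1 = K1 * K2 := hK12.symm
  have c122 : K2 * K1' = K1' * K2 := (aux_inv1 hK1 hK1' hK12).symm
  have c123 : K2' * K1 = K1 * K2' := aux_inv1 hK2 hK2' hK12.symm
  have c124 : K2' * K1' = K1' * K2' := aux_inv1 hK2 hK2' c122
  have c131 : K3 * K1 = K1 * K3 := hK13.symm
  have c132 : K3 * K1' = K1' * K3 := (aux_inv1 hK1 hK1' hK13).symm
  have c133 : K3' * K1 = K1 * K3' := aux_inv1 hK3 hK3' hK13.symm
  have c134 : K3' * K1' = K1' * K3' := aux_inv1 hK3 hK3' c132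
  have c231 : K3 * K2 = K2 * K3 := hK23.symm
  have c232 : K3 * K2' = K2' * K3 := (aux_inv1 hK2 hK2' hK23).symm
  have c233 : K3' * K2 = K2 * K3' := aux_inv1 hK3 hK3' hK23.symm
  have c234 : K3' * K2' = K2' * K3' := aux_inv1 hK3 hK3' c232
  have hK1E1' := aux_inv (d := q⁻¹) hqi hK1 hK1' hK1E1
  have hK2E1' := aux_inv (d := q) hqi' hK2 hK2' hK2E1
  have hK3E1' := aux_inv1 hK3 hK3' hK3E1
  have hK1E2' := aux_inv1 hK1 hK1' hK1E2
  have hK2E2' := aux_inv (d := q⁻¹) hqi hK2 hK2' hK2E2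
  have hK3E2' := aux_inv (d := q) hqi' hK3 hK3' hK3E2
  have hK1F1' := aux_inv (d := q) hqi' hK1 hK1' hK1F1
  have hK2F1' := aux_inv (d := q⁻¹) hqi hK2 hK2' hK2F1
  have hK3F1' := aux_inv1 hK3 hK3' hK3F1
  have hK1F2' := aux_inv1 hK1 hK1' hK1F2
  have hK2F2' := aux_inv (d := q) hqi' hK2 hK2' hK2F2
  have hK3F2' := aux_inv (d := q⁻¹) hqi hK3 hK3' hK3F2
  have rE1F1 : E1 * F1 = F1 * E1 + (q - q⁻¹)⁻¹ • (K1 * K2' - K1' * K2) := by rw [← hEF1]; abel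
  have rE2F2 : E2 * F2 = F2 * E2 + (q - q⁻¹)⁻¹ • (K2 * K3' - K2' * K3) := by rw [← hEF2]; abel
  have sE12 : E1 * E2 = E3 + q⁻¹ • (E2 * E1) := by
    rw [hE3]; abel
  have sF21 : F2 * F1 = F3 + q • (F1 * F2) := by
    rw [hF3]; abel
  have sE13 : E1 * E3 = q • (E3 * E1) := by
    rw [← sub_eq_zero, ← hSE1, hE3]
    simp only [pow_two, mul_assoc, mul_sub, sub_mul, smul_mul_assoc, mul_smul_comm, smul_sub, smul_smul]
    match_scalars <;> field_simp <;> ring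
  have sE32 : E3 * E2 = q • (E2 * E3) := by
    rw [← sub_eq_zero, ← hSE2, hE3]
    simp only [pow_two, mul_assoc, mul_sub, sub_mul, smul_mul_assoc, mul_smul_comm, smul_sub, smul_smul]
    match_scalars <;> field_simp <;> ring
  have sF31 : F3 * F1 = q⁻¹ • (F1 * F3) := by
    rw [← sub_eq_zero, ← hSF1, hF3]
    simp only [pow_two, mul_assoc, mul_sub, sub_mul, smul_mul_assoc, mul_smul_comm, smul_sub, smul_smul]
    match_scalars <;> field_simp <;> ring
  have sF23 : F2 * F3 = q⁻¹ • (F3 * F2) := by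
    rw [← sub_eq_zero, ← hSF2, hF3]
    simp only [pow_two, mul_assoc, mul_sub, sub_mul, smul_mul_assoc, mul_smul_comm, smul_sub, smul_smul]
    match_scalars <;> field_simp <;> ring
  obtain ⟨xE1F3, xE2F3, xE3F1, xE3F2, hK1E3, hK1E3', hK1F3, hK1F3', hK2E3, hK2E3', hK2F3, hK2F3', hK3E3, hK3E3', hK3F3, hK3F3'⟩ :
      E1 * F3 = F3 * E1 - q • (F2 * (K1 * K2')) ∧
      E2 * F3 = F3 * E2 + F1 * (K2' * K3) ∧
      E3 * F1 = F1 * E3 - E2 * (K1' * K2) ∧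
      E3 * F2 = F2 * E3 + q⁻¹ • (E1 * (K2 * K3')) ∧
      K1 * E3 = q • (E3 * K1) ∧
      K1' * E3 = q⁻¹ • (E3 * K1') ∧
      K1 * F3 = q⁻¹ • (F3 * K1) ∧
      K1' * F3 = q • (F3 * K1') ∧
      K2 * E3 = E3 * K2 ∧
      K2' * E3 = E3 * K2' ∧
      K2 * F3 = F3 * K2 ∧
      K2' * F3 = F3 * K2' ∧
      K3 * E3 = q⁻¹ • (E3 * K3) ∧
      K3' * E3 = q • (E3 * K3') ∧
      K3 * F3 = q • (F3 * K3) ∧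
      K3' * F3 = q⁻¹ • (F3 * K3') := by
    rw [hE3, hF3]
    refine ⟨?_, ?_, ?_, ?_, ?_, ?_, ?_, ?_, ?_, ?_, ?_, ?_, ?_, ?_, ?_, ?_⟩
    all_goals simp only [one_mul, mul_one, mul_assoc, mul_add, add_mul, mul_sub, sub_mul, neg_mul, mul_neg, smul_mul_assoc, mul_smul_comm, smul_add, smul_sub, smul_neg, smul_smul, hK1, hK1', hK2, hK2', hK3, hK3', c121, c122, c123, c124, c131, c132, c133, c134, c231, c232, c233, c234, hK1E1, hK1E1', hK2E1, hK2E1', hK3E1, hK3E1', hK1E2, hK1E2', hK2E2, hK2E2', hK3E2, hK3E2', hK1F1, hK1F1', hK2F1, hK2F1', hK3F1, hK3F1', hK1F2, hK1F2', hK2F2, hK2F2', hK3F2, hK3F2', rE1F1, rE2F2, hEF12, hEF21, aux_as hK1, aux_as hK1', aux_as hK2, aux_as hK2', aux_as hK3, aux_as hK3', aux_as c121, aux_as c122, aux_as c123, aux_as c124, aux_as c131, aux_as c132, aux_as c133, aux_as c134, aux_as c231, aux_as c232, aux_as c233, aux_as c234, aux_as hK1E1, aux_as hK1E1', aux_as hK2E1,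 aux_as hK2E1', aux_as hK3E1, aux_as hK3E1', aux_as hK1E2, aux_as hK1E2', aux_as hK2E2, aux_as hK2E2', aux_as hK3E2, aux_as hK3E2', aux_as hK1F1, aux_as hK1F1', aux_as hK2F1, aux_as hK2F1', aux_as hK3F1, aux_as hK3F1', aux_as hK1F2, aux_as hK1F2', aux_as hK2F2, aux_as hK2F2', aux_as hK3F2, aux_as hK3F2', aux_as rE1F1, aux_as rE2F2, aux_as hEF12, aux_as hEF21]
    all_goals (match_scalars <;> field_simp <;> ring)
  clear hE3 hF3
  refine ⟨?_, ?_, ?_, ?_, ?_, ?_, ?_⟩ <;> rw [hC2]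
  all_goals
    simp only [one_mul, mul_one, mul_assoc, mul_add, add_mul, mul_sub, sub_mul, neg_mul, mul_neg, smul_mul_assoc, mul_smul_comm, smul_add, smul_sub, smul_neg, smul_smul, hK1, hK1', hK2, hK2', hK3, hK3', c121, c122, c123, c124, c131, c132, c133, c134, c231, c232, c233, c234, hK1E1, hK1E1', hK2E1, hK2E1', hK3E1, hK3E1', hK1E2, hK1E2', hK2E2, hK2E2', hK3E2, hK3E2', hK1F1, hK1F1', hK2F1, hK2F1', hK3F1, hK3F1', hK1F2, hK1F2', hK2F2, hK2F2', hK3F2, hK3F2', rE1F1, rE2F2, hEF12, hEF21, xE1F3, xE2F3, xE3F1, xE3F2, hK1E3, hK1E3', hK1F3, hK1F3', hK2E3, hK2E3', hK2F3, hK2F3', hK3E3, hK3E3', hK3F3, hK3F3', sE12, sF21, sE13, sE32, sF31, sF23, aux_as hK1, aux_as hK1', aux_as hK2, aux_as hK2', aux_as hK3, aux_as hK3', aux_as c121, aux_as c122, aux_as c123, aux_as c124, aux_as c131, aux_as c132, aux_as c133, aux_as c134, aux_as c231, aux_as c232, aux_as c233, aux_as c234, aux_as hK1E1, aux_as hK1E1',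 aux_as hK2E1, aux_as hK2E1', aux_as hK3E1, aux_as hK3E1', aux_as hK1E2, aux_as hK1E2', aux_as hK2E2, aux_as hK2E2', aux_as hK3E2, aux_as hK3E2', aux_as hK1F1, aux_as hK1F1', aux_as hK2F1, aux_as hK2F1', aux_as hK3F1, aux_as hK3F1', aux_as hK1F2, aux_as hK1F2', aux_as hK2F2, aux_as hK2F2', aux_as hK3F2, aux_as hK3F2', aux_as rE1F1, aux_as rE2F2, aux_as hEF12, aux_as hEF21, aux_as xE1F3, aux_as xE2F3, aux_as xE3F1, aux_as xE3F2, aux_as hK1E3, aux_as hK1E3', aux_as hK1F3, aux_as hK1F3', aux_as hK2E3, aux_as hK2E3', aux_as hK2F3, aux_as hK2F3', aux_as hK3E3, aux_as hK3E3', aux_as hK3F3, aux_as hK3F3', aux_as sE12, aux_as sF21, aux_as sE13, aux_as sE32, aux_as sF31, aux_as sF23]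
    match_scalars <;> field_simp <;> ring
end

section
/- For all nonzero ζ₁, ζ₂ ∈ ℂ the basic monodromy matrix satisfies the RLL relation R̂(ζ₁ζ₂⁻¹)(M(ζ₁) ⊠ M(ζ₂)) = (M(ζ₂) ⊠ M(ζ₁))R̂(ζ₁ζ₂⁻¹), an equality of 9×9 matrices with entries in A. Here M(ζ) is the 3×3 matrix over A with entries M₁₁(ζ) = K₁ − ζ^{s_δ}K₁⁻¹, M₂₂(ζ) = K₂ − ζ^{s_δ}K₂⁻¹, M₃₃(ζ) = K₃ − ζ^{s_δ}K₃⁻¹, M₁₂(ζ) = ζ^{s_δ−s_α}κ_q K₁⁻¹F₁, M₁₃(ζ) = ζ^{s_δ−s_α−s_β}κ_q K₁⁻¹F₃, M₂₃(ζ) = ζ^{s_δ−s_β}κ_q K₂⁻¹F₂, M₂₁(ζ) = ζ^{s_α}κ_q E₁K₁, M₃₁(ζ) = ζ^{s_α+s_β}κ_q E₃K₁, M₃₂(ζ) = ζ^{s_β}κ_q E₂K₂; ⊠ denotes the Kronecker product with entries (X ⊠ Y)_{(a,b),(c,d)} = X_{ac}Y_{bd} multiplied in A in this order; R̂(ζ)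 = R(ζ)P, where P is the permutation matrix P_{(a,b),(c,d)} = δ_{ad}δ_{bc}, and R(ζ) is the complex 9×9 matrix, with rows and columns indexed by pairs (a,b), a,b ∈ {1,2,3}, whose only nonzero entries are R_{(a,a),(a,a)}(ζ) = q − q⁻¹ζ^{s_δ} for a = 1,2,3, R_{(a,b),(a,b)}(ζ) = 1 − ζ^{s_δ} for a ≠ b, R_{(1,2),(2,1)}(ζ) = ζ^{s_α}κ_q, R_{(2,1),(1,2)}(ζ) = ζ^{s_δ−s_α}κ_q, R_{(1,3),(3,1)}(ζ) = ζ^{s_α+s_β}κ_q, R_{(3,1),(1,3)}(ζ) = ζ^{s_δ−s_α−s_β}κ_q, R_{(2,3),(3,2)}(ζ) = ζ^{s_β}κ_q, R_{(3,2),(2,3)}(ζ) = ζ^{s_δ−s_β}κ_q. -/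
open scoped Matrix

/-- Kronecker product of two `3 × 3` matrices with (possibly noncommuting) entries,
`(X ⊠ Y)_{(a,b),(c,d)} = X_{ac} * Y_{bd}`. -/
def kron {A : Type*} [Mul A] (X Y : Matrix (Fin 3) (Fin 3) A) :
    Matrix (Fin 3 × Fin 3) (Fin 3 × Fin 3) A :=
  Matrix.of fun p r => X p.1 r.1 * Y p.2 r.2

/-- The `9 × 9` R-matrix of the vector evaluation representation of `U_q(L(sl₃))`
(with the scalar factor removed). -/
noncomputable def Rmat (q ζ : ℂ) (sα sβ sδ : ℤ) :
    Matrix (Fin 3 × Fin 3) (Fin 3 × Fin 3) ℂ :=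
  Matrix.of fun p r =>
    if p = r then (if p.1 = p.2 then q - q⁻¹ * ζ ^ sδ else 1 - ζ ^ sδ)
    else if p = ((0 : Fin 3), (1 : Fin 3)) ∧ r = ((1 : Fin 3), (0 : Fin 3)) then
      ζ ^ sα * (q - q⁻¹)
    else if p = ((1 : Fin 3), (0 : Fin 3)) ∧ r = ((0 : Fin 3), (1 : Fin 3)) then
      ζ ^ (sδ - sα) * (q - q⁻¹)
    else if p = ((0 : Fin 3), (2 : Fin 3)) ∧ r = ((2 : Fin 3), (0 : Fin 3)) then
      ζ ^ (sα + sβ) * (q - q⁻¹)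
    else if p = ((2 : Fin 3), (0 : Fin 3)) ∧ r = ((0 : Fin 3), (2 : Fin 3)) then
      ζ ^ (sδ - sα - sβ) * (q - q⁻¹)
    else if p = ((1 : Fin 3), (2 : Fin 3)) ∧ r = ((2 : Fin 3), (1 : Fin 3)) then
      ζ ^ sβ * (q - q⁻¹)
    else if p = ((2 : Fin 3), (1 : Fin 3)) ∧ r = ((1 : Fin 3), (2 : Fin 3)) then
      ζ ^ (sδ - sβ) * (q - q⁻¹)
    else 0

/-- The permutation matrix `P_{(a,b),(c,d)} = δ_{ad} δ_{bc}` on `ℂ³ ⊗ ℂ³`. -/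
def Pmat : Matrix (Fin 3 × Fin 3) (Fin 3 × Fin 3) ℂ :=
  Matrix.of fun p r => if p.1 = r.2 ∧ p.2 = r.1 then 1 else 0


noncomputable def rD (q d : ℂ) (i j : Fin 3) : ℂ := if i = j then q - q⁻¹ * d else 1 - d

noncomputable def rO (q d a b : ℂ) : Matrix (Fin 3) (Fin 3) ℂ :=
  !![0, a * (q - q⁻¹), (a * b) * (q - q⁻¹);
     (d / a) * (q - q⁻¹), 0, b * (q - q⁻¹);
     (d / a / b) * (q - q⁻¹), (d / b) * (q - q⁻¹), 0]

lemma RP_apply (q z : ℂ) (hz : z ≠ 0) (sα sβ sδ : ℤ) (i j k l : Fin 3) :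
    (Rmat q z sα sβ sδ * Pmat) (i, j) (k, l) =
      (if l = i ∧ k = j then rD q (z ^ sδ) i j else 0)
       + (if l = j ∧ k = i then rO q (z ^ sδ) (z ^ sα) (z ^ sβ) i j else 0) := by
  have h1 : (Rmat q z sα sβ sδ * Pmat) (i, j) (k, l) = Rmat q z sα sβ sδ (i, j) (l, k) := by
    rw [Matrix.mul_apply, Finset.sum_eq_single (l, k)]
    · simp [Pmat]
    · rintro ⟨x, y⟩ _ h
      have : ¬ (x = l ∧ y = k) := fun h' => h (by rw [h'.1, h'.2])
      simp [Pmat, this]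
    · simp
  rw [h1]
  fin_cases i <;> fin_cases j <;> fin_cases k <;> fin_cases l <;>
    simp [Rmat, rD, rO, zpow_sub₀ hz, zpow_add₀ hz]

lemma lhs_apply {A : Type*} [Ring A] [Algebra ℂ A] (X Y : Matrix (Fin 3) (Fin 3) A)
    (q z : ℂ) (hz : z ≠ 0) (sα sβ sδ : ℤ) (i j k l : Fin 3) :
    (((Rmat q z sα sβ sδ * Pmat).map (algebraMap ℂ A)) * kron X Y) (i, j) (k, l) =
      rD q (z ^ sδ) i j • (X j k * Y i l)
        + rO q (z ^ sδ) (z ^ sα) (z ^ sβ) i j • (X i k * Y j l) := by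
  rw [Matrix.mul_apply, Fintype.sum_prod_type]
  simp only [Matrix.map_apply, RP_apply q z hz, map_add, add_mul, Finset.sum_add_distrib, kron,
    Matrix.of_apply, ← Algebra.smul_def, ite_and, ite_smul, zero_smul]
  simp

lemma rD_symm (q d : ℂ) (i j : Fin 3) : rD q d i j = rD q d j i := by
  simp [rD, eq_comm]

lemma rhs_apply {A : Type*} [Ring A] [Algebra ℂ A] (X Y : Matrix (Fin 3) (Fin 3) A)
    (q z : ℂ) (hz : z ≠ 0) (sα sβ sδ : ℤ) (i j k l : Fin 3) :
    (kron Y X * ((Rmat q z sα sβ sδ * Pmat).map (algebraMap ℂ A))) (i, j) (k, l) =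
      rD q (z ^ sδ) k l • (Y i l * X j k)
        + rO q (z ^ sδ) (z ^ sα) (z ^ sβ) k l • (Y i k * X j l) := by
  rw [Matrix.mul_apply, Fintype.sum_prod_type]
  simp only [Matrix.map_apply, RP_apply q z hz, map_add, mul_add, Finset.sum_add_distrib, kron,
    Matrix.of_apply, ← Algebra.commutes, ← Algebra.smul_def, ite_and, ite_smul, zero_smul]
  rw [rD_symm]
  simp

lemma asc {A : Type*} [Ring A] {x y r : A} (h : x * y = r) (z : A) : x * (y * z) = r * z := by
  rw [← mul_assoc, h]

lemma comm_inv {A : Type*} [Ring A] [Algebra ℂ A] {K K' E : A} {c : ℂ} (hc : c ≠ 0)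
    (h1 : K * K' = 1) (h2 : K' * K = 1) (h : K * E = c • (E * K)) :
    K' * E = c⁻¹ • (E * K') := by
  have : E * K' = c • (K' * E) := by
    calc E * K' = K' * (K * E) * K' := by rw [← mul_assoc K', h2, one_mul]
      _ = c • (K' * E * (K * K')) := by
        rw [h]; simp only [mul_smul_comm, smul_mul_assoc, mul_assoc]
      _ = _ := by rw [h1, mul_one]
  rw [this, smul_smul, inv_mul_cancel₀ hc, one_smul]

lemma comm_inv1 {A : Type*} [Ring A] [Algebra ℂ A] {K K' E : A}
    (h1 : K * K' = 1) (h2 : K' * K = 1) (h : K * E = E * K) :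
    K' * E = E * K' := by
  have := comm_inv (c := 1) one_ne_zero h1 h2 (by simpa using h)
  simpa using this

set_option maxHeartbeats 0 in
/-- The basic monodromy matrix of `U_q(L(sl₃))` (with the central scalar factor
removed) satisfies the RLL relation with the vector representation R-matrix. -/
theorem monodromy_RLL
    {A : Type*} [Ring A] [Algebra ℂ A]
    (q : ℂ) (hq0 : q ≠ 0) (hq2 : q ^ 2 ≠ 1)
    (sα sβ sδ : ℤ)
    (K1 K2 K3 K1' K2' K3' E1 E2 F1 F2 E3 F3 : A)
    (hK1 : K1 * K1' = 1) (hK1' : K1' * K1 = 1)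
    (hK2 : K2 * K2' = 1) (hK2' : K2' * K2 = 1)
    (hK3 : K3 * K3' = 1) (hK3' : K3' * K3 = 1)
    (hK12 : K1 * K2 = K2 * K1) (hK13 : K1 * K3 = K3 * K1) (hK23 : K2 * K3 = K3 * K2)
    (hK1E1 : K1 * E1 = q • (E1 * K1)) (hK2E1 : K2 * E1 = q⁻¹ • (E1 * K2))
    (hK3E1 : K3 * E1 = E1 * K3)
    (hK1E2 : K1 * E2 = E2 * K1) (hK2E2 : K2 * E2 = q • (E2 * K2))
    (hK3E2 : K3 * E2 = q⁻¹ • (E2 * K3))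
    (hK1F1 : K1 * F1 = q⁻¹ • (F1 * K1)) (hK2F1 : K2 * F1 = q • (F1 * K2))
    (hK3F1 : K3 * F1 = F1 * K3)
    (hK1F2 : K1 * F2 = F2 * K1) (hK2F2 : K2 * F2 = q⁻¹ • (F2 * K2))
    (hK3F2 : K3 * F2 = q • (F2 * K3))
    (hEF1 : E1 * F1 - F1 * E1 = (q - q⁻¹)⁻¹ • (K1 * K2' - K1' * K2))
    (hEF2 : E2 * F2 - F2 * E2 = (q - q⁻¹)⁻¹ • (K2 * K3' - K2' * K3))
    (hEF12 : E1 * F2 = F2 * E1) (hEF21 : E2 * F1 = F1 * E2)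
    (hSE1 : E1 ^ 2 * E2 - (q + q⁻¹) • (E1 * E2 * E1) + E2 * E1 ^ 2 = 0)
    (hSE2 : E2 ^ 2 * E1 - (q + q⁻¹) • (E2 * E1 * E2) + E1 * E2 ^ 2 = 0)
    (hSF1 : F1 ^ 2 * F2 - (q + q⁻¹) • (F1 * F2 * F1) + F2 * F1 ^ 2 = 0)
    (hSF2 : F2 ^ 2 * F1 - (q + q⁻¹) • (F2 * F1 * F2) + F1 * F2 ^ 2 = 0)
    (hE3 : E3 = E1 * E2 - q⁻¹ • (E2 * E1))
    (hF3 : F3 = F2 * F1 - q • (F1 * F2))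
    (M : ℂ → Matrix (Fin 3) (Fin 3) A)
    (hM : ∀ ζ : ℂ, M ζ =
      !![K1 - (ζ ^ sδ) • K1',
         (ζ ^ (sδ - sα) * (q - q⁻¹)) • (K1' * F1),
         (ζ ^ (sδ - sα - sβ) * (q - q⁻¹)) • (K1' * F3);
         (ζ ^ sα * (q - q⁻¹)) • (E1 * K1),
         K2 - (ζ ^ sδ) • K2',
         (ζ ^ (sδ - sβ) * (q - q⁻¹)) • (K2' * F2);
         (ζ ^ (sα + sβ) * (q - q⁻¹)) • (E3 * K1),
         (ζ ^ sβ * (q - q⁻¹)) • (E2 * K2),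
         K3 - (ζ ^ sδ) • K3']) :
    ∀ ζ₁ ζ₂ : ℂ, ζ₁ ≠ 0 → ζ₂ ≠ 0 →
      ((Rmat q (ζ₁ * ζ₂⁻¹) sα sβ sδ * Pmat).map (algebraMap ℂ A)) * kron (M ζ₁) (M ζ₂)
        = kron (M ζ₂) (M ζ₁)
            * ((Rmat q (ζ₁ * ζ₂⁻¹) sα sβ sδ * Pmat).map (algebraMap ℂ A)) := by
  intro z w hz hw
  have hqi : q⁻¹ ≠ 0 := inv_ne_zero hq0
  have hk : q ^ 2 - 1 ≠ 0 := sub_ne_zero.2 hq2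
  have hκ : q - q⁻¹ ≠ 0 := by
    intro h; apply hk; field_simp at h; simpa using h
  have hkk : (q - q⁻¹)⁻¹ = q / (q ^ 2 - 1) := by
    field_simp
  rw [hkk] at hEF1 hEF2
  have c12 : K2 * K1 = K1 * K2 := hK12.symm
  have c12i : K2' * K1 = K1 * K2' := comm_inv1 hK2 hK2' hK12.symm
  have ci12 : K2 * K1' = K1' * K2 := (comm_inv1 hK1 hK1' hK12).symm
  have ci12i : K2' * K1' = K1' * K2' := comm_inv1 hK2 hK2' (comm_inv1 hK1 hK1' hK12).symm
  have c13 : K3 * K1 = K1 * K3 := hK13.symm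
  have c13i : K3' * K1 = K1 * K3' := comm_inv1 hK3 hK3' hK13.symm
  have ci13 : K3 * K1' = K1' * K3 := (comm_inv1 hK1 hK1' hK13).symm
  have ci13i : K3' * K1' = K1' * K3' := comm_inv1 hK3 hK3' (comm_inv1 hK1 hK1' hK13).symm
  have c23 : K3 * K2 = K2 * K3 := hK23.symm
  have c23i : K3' * K2 = K2 * K3' := comm_inv1 hK3 hK3' hK23.symm
  have ci23 : K3 * K2' = K2' * K3 := (comm_inv1 hK2 hK2' hK23).symm
  have ci23i : K3' * K2' = K2' * K3' := comm_inv1 hK3 hK3' (comm_inv1 hK2 hK2' hK23).symm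
  have hK1F1i : K1' * F1 = (q⁻¹)⁻¹ • (F1 * K1') := comm_inv hqi hK1 hK1' hK1F1
  have hK1F2i : K1' * F2 = F2 * K1' := comm_inv1 hK1 hK1' hK1F2
  have hK1E1i : K1' * E1 = (q)⁻¹ • (E1 * K1') := comm_inv hq0 hK1 hK1' hK1E1
  have r1E1 : E1 * K1 = (q)⁻¹ • (K1 * E1) := by rw [hK1E1, smul_smul, inv_mul_cancel₀ (by assumption), one_smul]
  have r1E1i : E1 * K1' = (q) • (K1' * E1) := by rw [hK1E1i, smul_smul, mul_inv_cancel₀ (by assumption), one_smul]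
  have hK1E2i : K1' * E2 = E2 * K1' := comm_inv1 hK1 hK1' hK1E2
  have r1E2 : E2 * K1 = K1 * E2 := hK1E2.symm
  have r1E2i : E2 * K1' = K1' * E2 := hK1E2i.symm
  have hK1F3 : K1 * F3 = q⁻¹ • (F3 * K1) := by
    rw [hF3]
    simp only [mul_add, mul_sub, add_mul, sub_mul, mul_smul_comm, smul_mul_assoc, mul_assoc, smul_add, smul_sub, smul_smul, asc hK1F1, asc hK1F2, hK1F1, hK1F2]
    try (match_scalars <;> field_simp)
  have hK1F3i : K1' * F3 = (q⁻¹)⁻¹ • (F3 * K1') := comm_inv hqi hK1 hK1' hK1F3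
  have hK1E3 : K1 * E3 = q • (E3 * K1) := by
    rw [hE3]
    simp only [mul_add, mul_sub, add_mul, sub_mul, mul_smul_comm, smul_mul_assoc, mul_assoc, smul_add, smul_sub, smul_smul, asc hK1E1, asc hK1E2, hK1E1, hK1E2]
    try (match_scalars <;> field_simp)
  have hK1E3i : K1' * E3 = (q)⁻¹ • (E3 * K1') := comm_inv hq0 hK1 hK1' hK1E3
  have r1E3 : E3 * K1 = (q)⁻¹ • (K1 * E3) := by rw [hK1E3, smul_smul, inv_mul_cancel₀ (by assumption), one_smul]
  have r1E3i : E3 * K1' = (q) • (K1' * E3) := by rw [hK1E3i, smul_smul, mul_inv_cancel₀ (by assumption), one_smul]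
  have hK2F1i : K2' * F1 = (q)⁻¹ • (F1 * K2') := comm_inv hq0 hK2 hK2' hK2F1
  have hK2F2i : K2' * F2 = (q⁻¹)⁻¹ • (F2 * K2') := comm_inv hqi hK2 hK2' hK2F2
  have hK2E1i : K2' * E1 = (q⁻¹)⁻¹ • (E1 * K2') := comm_inv hqi hK2 hK2' hK2E1
  have r2E1 : E1 * K2 = (q⁻¹)⁻¹ • (K2 * E1) := by rw [hK2E1, smul_smul, inv_mul_cancel₀ (by assumption), one_smul]
  have r2E1i : E1 * K2' = (q⁻¹) • (K2' * E1) := by rw [hK2E1i, smul_smul, mul_inv_cancel₀ (by assumption), one_smul]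
  have hK2E2i : K2' * E2 = (q)⁻¹ • (E2 * K2') := comm_inv hq0 hK2 hK2' hK2E2
  have r2E2 : E2 * K2 = (q)⁻¹ • (K2 * E2) := by rw [hK2E2, smul_smul, inv_mul_cancel₀ (by assumption), one_smul]
  have r2E2i : E2 * K2' = (q) • (K2' * E2) := by rw [hK2E2i, smul_smul, mul_inv_cancel₀ (by assumption), one_smul]
  have hK2F3 : K2 * F3 = F3 * K2 := by
    rw [hF3]
    simp only [mul_add, mul_sub, add_mul, sub_mul, mul_smul_comm, smul_mul_assoc, mul_assoc, smul_add, smul_sub, smul_smul, asc hK2F1, asc hK2F2, hK2F1, hK2F2]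
    try (match_scalars <;> field_simp)
  have hK2F3i : K2' * F3 = F3 * K2' := comm_inv1 hK2 hK2' hK2F3
  have hK2E3 : K2 * E3 = E3 * K2 := by
    rw [hE3]
    simp only [mul_add, mul_sub, add_mul, sub_mul, mul_smul_comm, smul_mul_assoc, mul_assoc, smul_add, smul_sub, smul_smul, asc hK2E1, asc hK2E2, hK2E1, hK2E2]
    try (match_scalars <;> field_simp)
  have hK2E3i : K2' * E3 = E3 * K2' := comm_inv1 hK2 hK2' hK2E3
  have r2E3 : E3 * K2 = K2 * E3 := hK2E3.symm
  have r2E3i : E3 * K2' = K2' * E3 := hK2E3i.symm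
  have hK3F1i : K3' * F1 = F1 * K3' := comm_inv1 hK3 hK3' hK3F1
  have hK3F2i : K3' * F2 = (q)⁻¹ • (F2 * K3') := comm_inv hq0 hK3 hK3' hK3F2
  have hK3E1i : K3' * E1 = E1 * K3' := comm_inv1 hK3 hK3' hK3E1
  have r3E1 : E1 * K3 = K3 * E1 := hK3E1.symm
  have r3E1i : E1 * K3' = K3' * E1 := hK3E1i.symm
  have hK3E2i : K3' * E2 = (q⁻¹)⁻¹ • (E2 * K3') := comm_inv hqi hK3 hK3' hK3E2
  have r3E2 : E2 * K3 = (q⁻¹)⁻¹ • (K3 * E2) := by rw [hK3E2, smul_smul, inv_mul_cancel₀ (by assumption), one_smul]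
  have r3E2i : E2 * K3' = (q⁻¹) • (K3' * E2) := by rw [hK3E2i, smul_smul, mul_inv_cancel₀ (by assumption), one_smul]
  have hK3F3 : K3 * F3 = q • (F3 * K3) := by
    rw [hF3]
    simp only [mul_add, mul_sub, add_mul, sub_mul, mul_smul_comm, smul_mul_assoc, mul_assoc, smul_add, smul_sub, smul_smul, asc hK3F1, asc hK3F2, hK3F1, hK3F2]
    try (match_scalars <;> field_simp)
  have hK3F3i : K3' * F3 = (q)⁻¹ • (F3 * K3') := comm_inv hq0 hK3 hK3' hK3F3
  have hK3E3 : K3 * E3 = q⁻¹ • (E3 * K3) := by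
    rw [hE3]
    simp only [mul_add, mul_sub, add_mul, sub_mul, mul_smul_comm, smul_mul_assoc, mul_assoc, smul_add, smul_sub, smul_smul, asc hK3E1, asc hK3E2, hK3E1, hK3E2]
    try (match_scalars <;> field_simp)
  have hK3E3i : K3' * E3 = (q⁻¹)⁻¹ • (E3 * K3') := comm_inv hqi hK3 hK3' hK3E3
  have r3E3 : E3 * K3 = (q⁻¹)⁻¹ • (K3 * E3) := by rw [hK3E3, smul_smul, inv_mul_cancel₀ (by assumption), one_smul]
  have r3E3i : E3 * K3' = (q⁻¹) • (K3' * E3) := by rw [hK3E3i, smul_smul, mul_inv_cancel₀ (by assumption), one_smul]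
  have e21 : E2 * E1 = q • (E1 * E2) - q • E3 := by rw [hE3]; match_scalars <;> field_simp <;> ring
  have e31 : E3 * E1 = q⁻¹ • (E1 * E3) := by
    have h : E1 * E3 - q • (E3 * E1) = 0 := by
      rw [← hSE1, hE3]
      simp only [mul_add, mul_sub, add_mul, sub_mul, mul_smul_comm, smul_mul_assoc, mul_assoc, smul_add, smul_sub, smul_smul, pow_two]
      match_scalars <;> field_simp <;> ring
    rw [sub_eq_zero.1 h, smul_smul, inv_mul_cancel₀ hq0, one_smul]
  have e23 : E2 * E3 = q⁻¹ • (E3 * E2) := by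
    have h : E3 * E2 - q • (E2 * E3) = 0 := by
      rw [← hSE2, hE3]
      simp only [mul_add, mul_sub, add_mul, sub_mul, mul_smul_comm, smul_mul_assoc, mul_assoc, smul_add, smul_sub, smul_smul, pow_two]
      match_scalars <;> field_simp <;> ring
    rw [sub_eq_zero.1 h, smul_smul, inv_mul_cancel₀ hq0, one_smul]
  have f21 : F2 * F1 = F3 + q • (F1 * F2) := by rw [hF3]; abel
  have f31 : F3 * F1 = q⁻¹ • (F1 * F3) := by
    rw [← sub_eq_zero, ← hSF1, hF3]
    simp only [mul_add, mul_sub, add_mul, sub_mul, mul_smul_comm, smul_mul_assoc, mul_assoc, smul_add, smul_sub, smul_smul, pow_two]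
    match_scalars <;> field_simp <;> ring
  have f23 : F2 * F3 = q⁻¹ • (F3 * F2) := by
    rw [← sub_eq_zero, ← hSF2, hF3]
    simp only [mul_add, mul_sub, add_mul, sub_mul, mul_smul_comm, smul_mul_assoc, mul_assoc, smul_add, smul_sub, smul_smul, pow_two]
    match_scalars <;> field_simp <;> ring
  have g11 : E1 * F1 = F1 * E1 + (q / (q ^ 2 - 1)) • (K1 * K2' - K1' * K2) := by rw [← hEF1]; abel
  have g22 : E2 * F2 = F2 * E2 + (q / (q ^ 2 - 1)) • (K2 * K3' - K2' * K3) := by rw [← hEF2]; abel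
  have g13 : E1 * F3 = F3 * E1 - q • (F2 * (K1 * K2')) := by
    rw [hF3]
    simp only [mul_add, mul_sub, add_mul, sub_mul, mul_smul_comm, smul_mul_assoc, mul_assoc, smul_add, smul_sub, smul_smul, hK1, hK1', hK2, hK2', hK3, hK3', c12, c12i, ci12, ci12i, c13, c13i, ci13, ci13i, c23, c23i, ci23, ci23i, hK1F1, hK1F1i, hK1F2, hK1F2i, r1E1, r1E1i, r1E2, r1E2i, hK1F3, hK1F3i, r1E3, r1E3i, hK2F1, hK2F1i, hK2F2, hK2F2i, r2E1, r2E1i, r2E2, r2E2i, hK2F3, hK2F3i, r2E3, r2E3i, hK3F1, hK3F1i, hK3F2, hK3F2i, r3E1, r3E1i, r3E2, r3E2i, hK3F3, hK3F3i, r3E3, r3E3i, g11, g22, hEF12, hEF21, asc hK1, asc hK1', asc hK2, asc hK2', asc hK3, asc hK3', asc c12, asc c12i, asc ci12, asc ci12i, asc c13, asc c13i, asc ci13, asc ci13i, asc c23, asc c23i, asc ci23, asc ci23i, asc hK1F1, asc hK1F1i, asc hK1F2, asc hK1F2i, asc r1E1, asc r1E1i, asc r1E2, asc r1E2i, asc hK1F3,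 asc hK1F3i, asc r1E3, asc r1E3i, asc hK2F1, asc hK2F1i, asc hK2F2, asc hK2F2i, asc r2E1, asc r2E1i, asc r2E2, asc r2E2i, asc hK2F3, asc hK2F3i, asc r2E3, asc r2E3i, asc hK3F1, asc hK3F1i, asc hK3F2, asc hK3F2i, asc r3E1, asc r3E1i, asc r3E2, asc r3E2i, asc hK3F3, asc hK3F3i, asc r3E3, asc r3E3i, asc g11, asc g22, asc hEF12, asc hEF21]
    match_scalars <;> field_simp <;> ring
  have g23 : E2 * F3 = F3 * E2 + F1 * (K2' * K3) := by
    rw [hF3]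
    simp only [mul_add, mul_sub, add_mul, sub_mul, mul_smul_comm, smul_mul_assoc, mul_assoc, smul_add, smul_sub, smul_smul, hK1, hK1', hK2, hK2', hK3, hK3', c12, c12i, ci12, ci12i, c13, c13i, ci13, ci13i, c23, c23i, ci23, ci23i, hK1F1, hK1F1i, hK1F2, hK1F2i, r1E1, r1E1i, r1E2, r1E2i, hK1F3, hK1F3i, r1E3, r1E3i, hK2F1, hK2F1i, hK2F2, hK2F2i, r2E1, r2E1i, r2E2, r2E2i, hK2F3, hK2F3i, r2E3, r2E3i, hK3F1, hK3F1i, hK3F2, hK3F2i, r3E1, r3E1i, r3E2, r3E2i, hK3F3, hK3F3i, r3E3, r3E3i, g11, g22, hEF12, hEF21, g13, asc hK1, asc hK1', asc hK2, asc hK2', asc hK3, asc hK3', asc c12, asc c12i, asc ci12, asc ci12i, asc c13, asc c13i, asc ci13, asc ci13i, asc c23, asc c23i, asc ci23, asc ci23i, asc hK1F1, asc hK1F1i, asc hK1F2, asc hK1F2i, asc r1E1, asc r1E1i, asc r1E2, asc r1E2i, asc hK1F3, asc hK1F3i, asc r1E3, asc r1E3i, asc hK2F1, asc hK2F1i, asc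 hK2F2, asc hK2F2i, asc r2E1, asc r2E1i, asc r2E2, asc r2E2i, asc hK2F3, asc hK2F3i, asc r2E3, asc r2E3i, asc hK3F1, asc hK3F1i, asc hK3F2, asc hK3F2i, asc r3E1, asc r3E1i, asc r3E2, asc r3E2i, asc hK3F3, asc hK3F3i, asc r3E3, asc r3E3i, asc g11, asc g22, asc hEF12, asc hEF21, asc g13]
    match_scalars <;> field_simp <;> ring
  have g31 : E3 * F1 = F1 * E3 - q⁻¹ • (K1' * (K2 * E2)) := by
    rw [hE3]
    simp only [mul_add, mul_sub, add_mul, sub_mul, mul_smul_comm, smul_mul_assoc, mul_assoc, smul_add, smul_sub, smul_smul, hK1, hK1', hK2, hK2', hK3, hK3', c12, c12i, ci12, ci12i, c13, c13i, ci13, ci13i, c23, c23i, ci23, ci23i, hK1F1, hK1F1i, hK1F2, hK1F2i, r1E1, r1E1i, r1E2, r1E2i, hK1F3, hK1F3i, r1E3, r1E3i, hK2F1, hK2F1i, hK2F2, hK2F2i, r2E1, r2E1i, r2E2, r2E2i, hK2F3, hK2F3i, r2E3, r2E3i, hK3F1, hK3F1i, hK3F2, hK3F2i, r3E1, r3E1i,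 r3E2, r3E2i, hK3F3, hK3F3i, r3E3, r3E3i, g11, g22, hEF12, hEF21, g13, g23, asc hK1, asc hK1', asc hK2, asc hK2', asc hK3, asc hK3', asc c12, asc c12i, asc ci12, asc ci12i, asc c13, asc c13i, asc ci13, asc ci13i, asc c23, asc c23i, asc ci23, asc ci23i, asc hK1F1, asc hK1F1i, asc hK1F2, asc hK1F2i, asc r1E1, asc r1E1i, asc r1E2, asc r1E2i, asc hK1F3, asc hK1F3i, asc r1E3, asc r1E3i, asc hK2F1, asc hK2F1i, asc hK2F2, asc hK2F2i, asc r2E1, asc r2E1i, asc r2E2, asc r2E2i, asc hK2F3, asc hK2F3i, asc r2E3, asc r2E3i, asc hK3F1, asc hK3F1i, asc hK3F2, asc hK3F2i, asc r3E1, asc r3E1i, asc r3E2, asc r3E2i, asc hK3F3, asc hK3F3i, asc r3E3, asc r3E3i, asc g11, asc g22, asc hEF12, asc hEF21, asc g13, asc g23]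
    match_scalars <;> field_simp <;> ring
  have g32 : E3 * F2 = F2 * E3 + K2 * (K3' * E1) := by
    rw [hE3]
    simp only [mul_add, mul_sub, add_mul, sub_mul, mul_smul_comm, smul_mul_assoc, mul_assoc, smul_add, smul_sub, smul_smul, hK1, hK1', hK2, hK2', hK3, hK3', c12, c12i, ci12, ci12i, c13, c13i, ci13, ci13i, c23, c23i, ci23, ci23i, hK1F1, hK1F1i, hK1F2, hK1F2i, r1E1, r1E1i, r1E2, r1E2i, hK1F3, hK1F3i, r1E3, r1E3i, hK2F1, hK2F1i, hK2F2, hK2F2i, r2E1, r2E1i, r2E2, r2E2i, hK2F3, hK2F3i, r2E3, r2E3i, hK3F1, hK3F1i, hK3F2, hK3F2i, r3E1, r3E1i, r3E2, r3E2i, hK3F3, hK3F3i, r3E3, r3E3i, g11, g22, hEF12, hEF21, g13, g23, g31, asc hK1, asc hK1', asc hK2, asc hK2', asc hK3, asc hK3', asc c12, asc c12i, asc ci12, asc ci12i, asc c13, asc c13i, asc ci13, asc ci13i, asc c23, asc c23i, asc ci23, asc ci23i, asc hK1F1, asc hK1F1i, asc hK1F2, asc hK1F2i, asc r1E1, asc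 r1E1i, asc r1E2, asc r1E2i, asc hK1F3, asc hK1F3i, asc r1E3, asc r1E3i, asc hK2F1, asc hK2F1i, asc hK2F2, asc hK2F2i, asc r2E1, asc r2E1i, asc r2E2, asc r2E2i, asc hK2F3, asc hK2F3i, asc r2E3, asc r2E3i, asc hK3F1, asc hK3F1i, asc hK3F2, asc hK3F2i, asc r3E1, asc r3E1i, asc r3E2, asc r3E2i, asc hK3F3, asc hK3F3i, asc r3E3, asc r3E3i, asc g11, asc g22, asc hEF12, asc hEF21, asc g13, asc g23, asc g31]
    match_scalars <;> field_simp <;> ring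
  have g33 : E3 * F3 = F3 * E3 + (q / (q ^ 2 - 1)) • (K1 * K3' - K1' * K3) := by
    have h : E3 * F3 = E3 * F2 * F1 - q • (E3 * F1 * F2) := by
      rw [hF3]; simp only [mul_add, mul_sub, add_mul, sub_mul, mul_smul_comm, smul_mul_assoc, mul_assoc, smul_add, smul_sub, smul_smul]
    rw [h, hF3]
    simp only [mul_add, mul_sub, add_mul, sub_mul, mul_smul_comm, smul_mul_assoc, mul_assoc, smul_add, smul_sub, smul_smul, one_mul, mul_one, hK1, hK1', hK2, hK2', hK3, hK3', c12, c12i, ci12, ci12i, c13, c13i, ci13, ci13i, c23, c23i, ci23, ci23i, hK1F1, hK1F1i, hK1F2, hK1F2i, r1E1, r1E1i, r1E2, r1E2i, hK1F3, hK1F3i, r1E3, r1E3i, hK2F1, hK2F1i, hK2F2, hK2F2i, r2E1, r2E1i, r2E2, r2E2i, hK2F3, hK2F3i, r2E3, r2E3i, hK3F1, hK3F1i, hK3F2, hK3F2i, r3E1, r3E1i, r3E2, r3E2i, hK3F3, hK3F3i, r3E3, r3E3i, g11, g22, hEF12, hEF21, g13, g23, g31, g32, asc hK1, asc hK1', asc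 hK2, asc hK2', asc hK3, asc hK3', asc c12, asc c12i, asc ci12, asc ci12i, asc c13, asc c13i, asc ci13, asc ci13i, asc c23, asc c23i, asc ci23, asc ci23i, asc hK1F1, asc hK1F1i, asc hK1F2, asc hK1F2i, asc r1E1, asc r1E1i, asc r1E2, asc r1E2i, asc hK1F3, asc hK1F3i, asc r1E3, asc r1E3i, asc hK2F1, asc hK2F1i, asc hK2F2, asc hK2F2i, asc r2E1, asc r2E1i, asc r2E2, asc r2E2i, asc hK2F3, asc hK2F3i, asc r2E3, asc r2E3i, asc hK3F1, asc hK3F1i, asc hK3F2, asc hK3F2i, asc r3E1, asc r3E1i, asc r3E2, asc r3E2i, asc hK3F3, asc hK3F3i, asc r3E3, asc r3E3i, asc g11, asc g22, asc hEF12, asc hEF21, asc g13, asc g23, asc g31, asc g32]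
    match_scalars <;> field_simp <;> ring

  have hza := zpow_ne_zero sα hz
  have hzb := zpow_ne_zero sβ hz
  have hzd := zpow_ne_zero sδ hz
  have hwa := zpow_ne_zero sα hw
  have hwb := zpow_ne_zero sβ hw
  have hwd := zpow_ne_zero sδ hw
  ext ⟨i, j⟩ ⟨k, l⟩
  rw [lhs_apply _ _ _ _ (mul_ne_zero hz (inv_ne_zero hw)),
    rhs_apply _ _ _ _ (mul_ne_zero hz (inv_ne_zero hw)), hM z, hM w]
  simp only [mul_zpow, inv_zpow, zpow_sub₀ hz, zpow_add₀ hz, zpow_sub₀ hw, zpow_add₀ hw]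
  generalize z ^ sα = a at *
  generalize z ^ sβ = b at *
  generalize z ^ sδ = d at *
  generalize w ^ sα = a' at *
  generalize w ^ sβ = b' at *
  generalize w ^ sδ = d' at *
  clear hE3 hF3 hSE1 hSE2 hSF1 hSF2 hM hEF1 hEF2
  obtain ⟨κ, hκd⟩ : ∃ κ, κ = q - q⁻¹ := ⟨_, rfl⟩
  rw [← hκd]
  fin_cases i <;> fin_cases j <;> fin_cases k <;> fin_cases l <;>
    simp only [Fin.zero_eta, Fin.mk_one, Fin.reduceFinMk, Fin.isValue, Fin.reduceEq, if_true, if_false, reduceIte,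
      Matrix.of_apply, Matrix.cons_val', Matrix.cons_val, Matrix.cons_val_zero, Matrix.cons_val_one] <;>
    (try simp only [mul_add, mul_sub, add_mul, sub_mul, mul_smul_comm, smul_mul_assoc, mul_assoc, smul_add, smul_sub, smul_smul, one_mul, mul_one, hK1, hK1', hK2, hK2', hK3, hK3', c12, c12i, ci12, ci12i, c13, c13i, ci13, ci13i, c23, c23i, ci23, ci23i, hK1F1, hK1F1i, hK1F2, hK1F2i, r1E1, r1E1i, r1E2, r1E2i, hK1F3, hK1F3i, r1E3, r1E3i, hK2F1, hK2F1i, hK2F2, hK2F2i, r2E1, r2E1i, r2E2, r2E2i, hK2F3, hK2F3i, r2E3, r2E3i, hK3F1, hK3F1i, hK3F2, hK3F2i, r3E1, r3E1i, r3E2, r3E2i, hK3F3, hK3F3i, r3E3, r3E3i, e21, e31, e23, f21, f31, f23, g11, g22, hEF12, hEF21, g13, g23, g31, g32, g33, asc hK1, asc hK1', asc hK2, asc hK2', asc hK3, asc hK3', asc c12, asc c12i, asc ci12, asc ci12i, asc c13, asc c13i, asc ci13, asc ci13i, asc c23, asc c23i, asc ci23, asc ci23i, asc hK1F1, asc hK1F1i,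 asc hK1F2, asc hK1F2i, asc r1E1, asc r1E1i, asc r1E2, asc r1E2i, asc hK1F3, asc hK1F3i, asc r1E3, asc r1E3i, asc hK2F1, asc hK2F1i, asc hK2F2, asc hK2F2i, asc r2E1, asc r2E1i, asc r2E2, asc r2E2i, asc hK2F3, asc hK2F3i, asc r2E3, asc r2E3i, asc hK3F1, asc hK3F1i, asc hK3F2, asc hK3F2i, asc r3E1, asc r3E1i, asc r3E2, asc r3E2i, asc hK3F3, asc hK3F3i, asc r3E3, asc r3E3i, asc e21, asc e31, asc e23, asc f21, asc f31, asc f23, asc g11, asc g22, asc hEF12, asc hEF21, asc g13, asc g23, asc g31, asc g32, asc g33]) <;>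
    simp only [hκd, rD, rO, Fin.isValue, Fin.reduceEq, if_true, if_false, reduceIte,
      Matrix.of_apply, Matrix.cons_val', Matrix.cons_val, Matrix.cons_val_zero, Matrix.cons_val_one, zero_smul, zero_mul, add_zero, sub_zero] <;>
    match_scalars <;> field_simp <;> ring
end

section
/- The 9×9 R-matrix of the vector evaluation representation satisfies the Yang–Baxter equation with spectral parameters: for all nonzero ζ₁, ζ₂, ζ₃ ∈ ℂ, R¹²(ζ₁ζ₂⁻¹)R¹³(ζ₁ζ₃⁻¹)R²³(ζ₂ζ₃⁻¹) = R²³(ζ₂ζ₃⁻¹)R¹³(ζ₁ζ₃⁻¹)R¹²(ζ₁ζ₂⁻¹) as linear operators on ℂ³ ⊗ ℂ³ ⊗ ℂ³, where R^{ij}(ζ) acts as R(ζ) on the i-th and j-th tensor factors and as the identity on the remaining factor. -/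
/-- `R(ζ)` acting on the first and second factors of `ℂ³ ⊗ ℂ³ ⊗ ℂ³`. -/
noncomputable def R12 (q ζ : ℂ) (sα sβ sδ : ℤ) :
    Matrix (Fin 3 × Fin 3 × Fin 3) (Fin 3 × Fin 3 × Fin 3) ℂ :=
  Matrix.of fun p r =>
    Rmat q ζ sα sβ sδ (p.1, p.2.1) (r.1, r.2.1) * (if p.2.2 = r.2.2 then 1 else 0)

/-- `R(ζ)` acting on the first and third factors of `ℂ³ ⊗ ℂ³ ⊗ ℂ³`. -/
noncomputable def R13 (q ζ : ℂ) (sα sβ sδ : ℤ) :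
    Matrix (Fin 3 × Fin 3 × Fin 3) (Fin 3 × Fin 3 × Fin 3) ℂ :=
  Matrix.of fun p r =>
    Rmat q ζ sα sβ sδ (p.1, p.2.2) (r.1, r.2.2) * (if p.2.1 = r.2.1 then 1 else 0)

/-- `R(ζ)` acting on the second and third factors of `ℂ³ ⊗ ℂ³ ⊗ ℂ³`. -/
noncomputable def R23 (q ζ : ℂ) (sα sβ sδ : ℤ) :
    Matrix (Fin 3 × Fin 3 × Fin 3) (Fin 3 × Fin 3 × Fin 3) ℂ :=
  Matrix.of fun p r =>
    Rmat q ζ sα sβ sδ (p.2.1, p.2.2) (r.2.1, r.2.2) * (if p.1 = r.1 then 1 else 0)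

noncomputable def DD (q x : ℂ) (a b : Fin 3) : ℂ := if a = b then q - q⁻¹ * x else 1 - x

noncomputable def GG (q x s t : ℂ) : Fin 3 → Fin 3 → ℂ :=
  ![![0, s * (q - q⁻¹), s * t * (q - q⁻¹)],
    ![x / s * (q - q⁻¹), 0, t * (q - q⁻¹)],
    ![x / s / t * (q - q⁻¹), x / t * (q - q⁻¹), 0]]

theorem Rmat_eq (q ζ : ℂ) (h : ζ ≠ 0) (sα sβ sδ : ℤ) (a b c d : Fin 3) :
    Rmat q ζ sα sβ sδ (a, b) (c, d) =
      (if c = a then if d = b then DD q (ζ ^ sδ) a b else 0 else 0) +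
      (if c = b then if d = a then GG q (ζ ^ sδ) (ζ ^ sα) (ζ ^ sβ) a b else 0 else 0) := by
  fin_cases a <;> fin_cases b <;> fin_cases c <;> fin_cases d <;>
    simp [Rmat, DD, GG, zpow_sub₀ h, zpow_add₀ h]

theorem R12_mulVec (q ζ : ℂ) (h : ζ ≠ 0) (sα sβ sδ : ℤ) (v : Fin 3 × Fin 3 × Fin 3 → ℂ)
    (a b c : Fin 3) :
    (R12 q ζ sα sβ sδ).mulVec v (a, b, c) = DD q (ζ ^ sδ) a b * v (a, b, c)
      + GG q (ζ ^ sδ) (ζ ^ sα) (ζ ^ sβ) a b * v (b, a, c) := by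
  simp [Matrix.mulVec, dotProduct, R12, Rmat_eq q ζ h, Fintype.sum_prod_type, add_mul,
    Finset.sum_add_distrib]

theorem R13_mulVec (q ζ : ℂ) (h : ζ ≠ 0) (sα sβ sδ : ℤ) (v : Fin 3 × Fin 3 × Fin 3 → ℂ)
    (a b c : Fin 3) :
    (R13 q ζ sα sβ sδ).mulVec v (a, b, c) = DD q (ζ ^ sδ) a c * v (a, b, c)
      + GG q (ζ ^ sδ) (ζ ^ sα) (ζ ^ sβ) a c * v (c, b, a) := by
  simp [Matrix.mulVec, dotProduct, R13, Rmat_eq q ζ h, Fintype.sum_prod_type, add_mul,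
    Finset.sum_add_distrib]

theorem R23_mulVec (q ζ : ℂ) (h : ζ ≠ 0) (sα sβ sδ : ℤ) (v : Fin 3 × Fin 3 × Fin 3 → ℂ)
    (a b c : Fin 3) :
    (R23 q ζ sα sβ sδ).mulVec v (a, b, c) = DD q (ζ ^ sδ) b c * v (a, b, c)
      + GG q (ζ ^ sδ) (ζ ^ sα) (ζ ^ sβ) b c * v (a, c, b) := by
  simp [Matrix.mulVec, dotProduct, R23, Rmat_eq q ζ h, Fintype.sum_prod_type, add_mul,
    Finset.sum_add_distrib]

/-- The R-matrix of the vector evaluation representation of `U_q(L(sl₃))` satisfies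
the Yang–Baxter equation with spectral parameters. -/
theorem yang_baxter_vector_rep
    (q : ℂ) (hq0 : q ≠ 0) (hq2 : q ^ 2 ≠ 1) (sα sβ sδ : ℤ) :
    ∀ ζ₁ ζ₂ ζ₃ : ℂ, ζ₁ ≠ 0 → ζ₂ ≠ 0 → ζ₃ ≠ 0 →
      R12 q (ζ₁ * ζ₂⁻¹) sα sβ sδ * R13 q (ζ₁ * ζ₃⁻¹) sα sβ sδ
          * R23 q (ζ₂ * ζ₃⁻¹) sα sβ sδ
        = R23 q (ζ₂ * ζ₃⁻¹) sα sβ sδ * R13 q (ζ₁ * ζ₃⁻¹) sα sβ sδ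
          * R12 q (ζ₁ * ζ₂⁻¹) sα sβ sδ := by
  intro ζ₁ ζ₂ ζ₃ h1 h2 h3
  have h12 : ζ₁ * ζ₂⁻¹ ≠ 0 := mul_ne_zero h1 (inv_ne_zero h2)
  have h23 : ζ₂ * ζ₃⁻¹ ≠ 0 := mul_ne_zero h2 (inv_ne_zero h3)
  have e : ζ₁ * ζ₃⁻¹ = (ζ₁ * ζ₂⁻¹) * (ζ₂ * ζ₃⁻¹) := by field_simp
  rw [e]
  generalize ζ₁ * ζ₂⁻¹ = z at *
  generalize ζ₂ * ζ₃⁻¹ = w at *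
  have h13 : z * w ≠ 0 := mul_ne_zero h12 h23
  apply Matrix.ext_of_mulVec_single
  intro i
  generalize (Pi.single i 1 : Fin 3 × Fin 3 × Fin 3 → ℂ) = v
  ext ⟨a, b, c⟩
  simp only [← Matrix.mulVec_mulVec, R12_mulVec q z h12, R13_mulVec q _ h13, R23_mulVec q w h23,
    mul_zpow]
  have n1 := zpow_ne_zero sα h12
  have n2 := zpow_ne_zero sβ h12
  have n3 := zpow_ne_zero sα h23
  have n4 := zpow_ne_zero sβ h23
  generalize z ^ sα = z1 at *
  generalize z ^ sβ = z2 at *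
  generalize z ^ sδ = x at *
  generalize w ^ sα = w1 at *
  generalize w ^ sβ = w2 at *
  generalize w ^ sδ = y at *
  clear h12 h23 h13 e
  fin_cases a <;> fin_cases b <;> fin_cases c <;> simp [DD, GG] <;> field_simp <;> ring
end
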